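/- Let α ∈ ℝ, α ≠ 0, and set E₁ := −exp(4π/α). Then for every λ ∈ ℂ\{0}: d(k_{E₁}(λ)) := 1 − (α/(2π))·ln(|Re k_{E₁}(λ)| + |Im k_{E₁}(λ)|) = 0 if and only if |λ| = 1. Hence the Faddeev generalized scattering data a(k_{E₁}(λ)) = b(k_{E₁}(λ)) = (2π)⁻²·α/d(k_{E₁}(λ)) are singular in λ exactly on the unit circle T = {λ ∈ ℂ : |λ| = 1} and are continuous on (ℂ ∪ {∞})\T. -/

import Mathlib

/-- The principal square root of a real number, viewed in `ℂ`
(so `√E = i√(−E)` for `E < 0`). -/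
noncomputable def sqrtC (E : ℝ) : ℂ := (E : ℂ) ^ (1/2 : ℂ)

/-- The rational parametrization `k_E(λ) = ((λ + λ⁻¹)√E/2, i(λ⁻¹ − λ)√E/2) ∈ ℂ²`
of the fixed-energy surface `{k ∈ ℂ² : k² = E}`. -/
noncomputable def kE (E : ℝ) (lam : ℂ) : ℂ × ℂ :=
  ((lam + lam⁻¹) * sqrtC E / 2, Complex.I * (lam⁻¹ - lam) * sqrtC E / 2)

/-- Euclidean norm `|Re k|` of the componentwise real part of `k ∈ ℂ²`. -/
noncomputable def normRe (k : ℂ × ℂ) : ℝ := Real.sqrt (k.1.re ^ 2 + k.2.re ^ 2)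

/-- Euclidean norm `|Im k|` of the componentwise imaginary part of `k ∈ ℂ²`. -/
noncomputable def normIm (k : ℂ × ℂ) : ℝ := Real.sqrt (k.1.im ^ 2 + k.2.im ^ 2)

/-- The denominator `d(k) = 1 − (α/2π)·ln(|Re k| + |Im k|)` of the Faddeev generalized
scattering data `a(k) = b(k) = (2π)⁻²·α/d(k)` of the 2D point potential of strength `α`. -/
noncomputable def dFad (α : ℝ) (k : ℂ × ℂ) : ℝ :=
  1 - α / (2 * Real.pi) * Real.log (normRe k + normIm k)

theorem aux_sqrtC (α : ℝ) : sqrtC (-Real.exp (4 * Real.pi / α)) =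
    Complex.I * (Real.exp (2 * Real.pi / α) : ℂ) := by
  have h1 : ((-Real.exp (4 * Real.pi / α) : ℝ) : ℂ) =
      Complex.exp (((4 * Real.pi / α : ℝ) : ℂ) + Real.pi * Complex.I) := by
    rw [Complex.exp_add, Complex.exp_pi_mul_I]
    push_cast
    ring
  have hne : ((-Real.exp (4 * Real.pi / α) : ℝ) : ℂ) ≠ 0 := by
    rw [h1]; exact Complex.exp_ne_zero _
  unfold sqrtC
  rw [Complex.cpow_def_of_ne_zero hne, h1, Complex.log_exp]
  · have : (((4 * Real.pi / α : ℝ) : ℂ) + Real.pi * Complex.I) * (1 / 2) =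
        Real.pi / 2 * Complex.I + ((2 * Real.pi / α : ℝ) : ℂ) := by
      push_cast; ring
    rw [this, Complex.exp_add, Complex.exp_pi_div_two_mul_I, Complex.ofReal_exp]
  · simp; linarith [Real.pi_pos]
  · simp

theorem aux_sum (r s : ℝ) (hr : 0 < r) :
    s / 2 * |r - r⁻¹| + s / 2 * (r + r⁻¹) = s * Real.exp |Real.log r| := by
  rcases le_total 1 r with h | h
  · have h2 : r⁻¹ ≤ 1 := inv_le_one_of_one_le₀ h
    rw [abs_of_nonneg (by linarith : 0 ≤ r - r⁻¹), abs_of_nonneg (Real.log_nonneg h),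
      Real.exp_log hr]
    ring
  · have h2 : 1 ≤ r⁻¹ := (one_le_inv₀ hr).2 h
    rw [abs_of_nonpos (by linarith : r - r⁻¹ ≤ 0), abs_of_nonpos (Real.log_nonpos hr.le h),
      Real.exp_neg, Real.exp_log hr]
    ring

theorem aux_norms (α : ℝ) (lam : ℂ) (hl : lam ≠ 0) :
    normRe (kE (-Real.exp (4 * Real.pi / α)) lam) +
      normIm (kE (-Real.exp (4 * Real.pi / α)) lam) =
    Real.exp (2 * Real.pi / α) * Real.exp |Real.log ‖lam‖| := by
  have hr : 0 < ‖lam‖ := norm_pos_iff.2 hl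
  rw [← aux_sum _ _ hr]
  have hs : 0 < Real.exp (2 * Real.pi / α) := Real.exp_pos _
  have hN : Complex.normSq lam = ‖lam‖ ^ 2 := Complex.normSq_eq_norm_sq lam
  have hxy : lam.re ^ 2 + lam.im ^ 2 = ‖lam‖ ^ 2 := by
    rw [← hN, Complex.normSq_apply]; ring
  unfold normRe normIm kE
  simp only [aux_sqrtC]
  generalize Real.exp (2 * Real.pi / α) = s at *
  generalize ‖lam‖ = r at *
  congr 1
  · rw [← Real.sqrt_sq (by positivity : 0 ≤ s / 2 * |r - r⁻¹|)]
    congr 1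
    rw [mul_pow, sq_abs]
    simp [hN]
    trans (s/2)^2 * (lam.re ^ 2 + lam.im ^ 2) * (1 - (r^2)⁻¹)^2
    · ring
    · rw [hxy]; field_simp
  · rw [← Real.sqrt_sq (by positivity : 0 ≤ s / 2 * (r + r⁻¹))]
    congr 1
    rw [mul_pow]
    simp [hN]
    trans (s/2)^2 * (lam.re ^ 2 + lam.im ^ 2) * (1 + (r^2)⁻¹)^2
    · ring
    · rw [hxy]; field_simp

theorem aux_d (α : ℝ) (hα : α ≠ 0) (lam : ℂ) (hl : lam ≠ 0) :
    dFad α (kE (-Real.exp (4 * Real.pi / α)) lam) =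
      -(α / (2 * Real.pi)) * |Real.log ‖lam‖| := by
  unfold dFad
  have := Real.pi_ne_zero
  rw [aux_norms α lam hl, ← Real.exp_add, Real.log_exp]
  field_simp
  ring

theorem aux_iff (α : ℝ) (hα : α ≠ 0) (lam : ℂ) (hl : lam ≠ 0) :
    dFad α (kE (-Real.exp (4 * Real.pi / α)) lam) = 0 ↔ ‖lam‖ = 1 := by
  have hr : 0 < ‖lam‖ := norm_pos_iff.2 hl
  have hc : -(α / (2 * Real.pi)) ≠ 0 :=
    neg_ne_zero.2 (div_ne_zero hα (by positivity))
  rw [aux_d α hα lam hl, mul_eq_zero, or_iff_right hc, abs_eq_zero]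
  constructor
  · exact Real.eq_one_of_pos_of_log_eq_zero hr
  · intro h; simp [h]

/-- Let `α ≠ 0`, `E₁ := −exp(4π/α)`. Then for every `λ ∈ ℂ\{0}`:
`d(k_{E₁}(λ)) = 0 ↔ |λ| = 1`; hence the Faddeev generalized scattering data
`a(k_{E₁}(λ)) = b(k_{E₁}(λ)) = (2π)⁻²·α/d(k_{E₁}(λ))` are singular in `λ` exactly on
the unit circle and continuous off it. -/
theorem point_potential_data_singular_at_ground_state
    (α : ℝ) (hα : α ≠ 0) :
    (∀ lam : ℂ, lam ≠ 0 →
      (dFad α (kE (-Real.exp (4 * Real.pi / α)) lam) = 0 ↔ ‖lam‖ = 1)) ∧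
    ContinuousOn
      (fun lam : ℂ =>
        ((2 * Real.pi) ^ 2)⁻¹ * α / dFad α (kE (-Real.exp (4 * Real.pi / α)) lam))
      {lam : ℂ | lam ≠ 0 ∧ ‖lam‖ ≠ 1} := by
  refine ⟨fun lam hl => aux_iff α hα lam hl, ?_⟩
  refine ContinuousOn.div continuousOn_const ?_
    (fun lam hl h => hl.2 ((aux_iff α hα lam hl.1).1 h))
  refine ContinuousOn.congr (f := fun lam : ℂ => -(α / (2 * Real.pi)) * |Real.log ‖lam‖|) ?_
    (fun lam hl => aux_d α hα lam hl.1)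
  refine continuousOn_const.mul (ContinuousOn.abs ?_)
  exact ContinuousOn.log continuous_norm.continuousOn (fun lam hl => norm_ne_zero_iff.2 hl.1)
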